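/- Let d ≥ 1, let k ≥ 1, p ≥ 1 be integers, let 1 ≤ j ≤ k, and let α > d/2. Then there exists a constant C_α > 0, depending only on α, d, p (and independent of k and j), such that for every Schwartz function γ on ℝ^{d(k+p)} × ℝ^{d(k+p)} one has ‖S^{(k,α)} B_{j;k+1,…,k+p} γ‖_{L²(ℝ^{dk} × ℝ^{dk})} ≤ C_α ‖S^{(k+p,α)} γ‖_{L²(ℝ^{d(k+p)} × ℝ^{d(k+p)})}. -/

import Mathlib

open MeasureTheory
open scoped FourierTransform ENNReal

/-- Interpret a plain function on the index set as a point of the corresponding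
Euclidean space (they are definitionally equal). -/
noncomputable def toEuc (ι : Type*) [Fintype ι] (g : ι → ℝ) : EuclideanSpace ℝ ι := WithLp.toLp 2 g

/-- The pair space `ℝ^{dn} × ℝ^{dn}`, realized as one Euclidean space: the `Sum.inl`
indices are the unprimed variables `(x₁,…,x_n)` and the `Sum.inr` indices the primed
variables `(x'₁,…,x'_n)`. -/
abbrev PairSpace (d n : ℕ) :=
  EuclideanSpace ℝ ((Fin n × Fin d) ⊕ (Fin n × Fin d))

/-- The contraction operator `B_{j;k+1,…,k+p}`. -/
noncomputable def contractB (d k p : ℕ) (j : Fin k)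
    (γ : PairSpace d (k + p) → ℂ) (z : PairSpace d k) : ℂ :=
  let x : Fin k → Fin d → ℝ := fun l i => z (Sum.inl (l, i))
  let x' : Fin k → Fin d → ℝ := fun l i => z (Sum.inr (l, i))
  let ext : (Fin k → Fin d → ℝ) → (Fin d → ℝ) → (Fin (k + p) × Fin d) → ℝ :=
    fun w y q => if h : (q.1 : ℕ) < k then w ⟨q.1, h⟩ q.2 else y q.2
  γ (toEuc _ (Sum.elim (ext x (x j)) (ext x' (x j)))) -
    γ (toEuc _ (Sum.elim (ext x (x' j)) (ext x' (x' j))))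

/-- The symbol of the Fourier multiplier `S^{(n,α)}`:
`∏_{l=1}^n ⟨ξ_l⟩^α ⟨ξ'_l⟩^α` with `⟨ξ⟩ = (1+|ξ|²)^{1/2}`. -/
noncomputable def weightS (d n : ℕ) (α : ℝ) (ζ : PairSpace d n) : ℝ :=
  ∏ l : Fin n,
    ((1 + ∑ i : Fin d, (ζ (Sum.inl (l, i))) ^ 2) ^ (α / 2) *
      (1 + ∑ i : Fin d, (ζ (Sum.inr (l, i))) ^ 2) ^ (α / 2))


set_option linter.unusedSectionVars false

section AbstractPart
variable {E F H : Type*}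
  [NormedAddCommGroup E] [InnerProductSpace ℝ E] [FiniteDimensional ℝ E]
  [MeasurableSpace E] [BorelSpace E]
  [NormedAddCommGroup F] [InnerProductSpace ℝ F] [FiniteDimensional ℝ F]
  [MeasurableSpace F] [BorelSpace F]
  [NormedAddCommGroup H] [InnerProductSpace ℝ H] [FiniteDimensional ℝ H]
  [MeasurableSpace H] [BorelSpace H]

theorem fiber_continuous (h : SchwartzMap (E × F) ℂ) :
    Continuous (fun ξ : E => ∫ y : F, h (ξ, y)) := by
  obtain ⟨C, hC⟩ : ∃ C : ℝ, ∀ z, (1 + ‖z‖) ^ (Module.finrank ℝ F + 1) * ‖h z‖ ≤ C := by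
    refine ⟨2 ^ (Module.finrank ℝ F + 1) *
      ((Finset.Iic ((Module.finrank ℝ F + 1, 0) : ℕ × ℕ)).sup
        (fun m' => SchwartzMap.seminorm ℝ m'.1 m'.2) h), fun z => ?_⟩
    simpa using SchwartzMap.one_add_le_sup_seminorm_apply (𝕜 := ℝ)
      (m := (Module.finrank ℝ F + 1, 0)) (k := Module.finrank ℝ F + 1) (n := 0) le_rfl le_rfl h z
  have hC0 : 0 ≤ C := le_trans (by positivity) (hC 0)
  refine continuous_of_dominated
    (bound := fun y => C * (1 + ‖y‖) ^ (-((Module.finrank ℝ F + 1 : ℕ) : ℝ))) ?_ ?_ ?_ ?_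
  · intro ξ
    exact (h.continuous.comp (by fun_prop)).aestronglyMeasurable
  · intro ξ
    refine Filter.Eventually.of_forall fun y => ?_
    rw [Real.rpow_neg (by positivity), ← div_eq_mul_inv, le_div_iff₀' (by positivity),
      Real.rpow_natCast]
    refine le_trans ?_ (hC (ξ, y))
    gcongr
    exact norm_snd_le (ξ, y)
  · exact (integrable_one_add_norm (by push_cast; linarith)).const_mul C
  · refine Filter.Eventually.of_forall fun y => ?_
    exact h.continuous.comp (by fun_prop)

theorem comp_integrable (Φ : (E × F) ≃L[ℝ] H) (L : E →ₗ[ℝ] H)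
    (hL : ∀ ξ y z, inner ℝ (Φ (ξ, y)) (L z) = inner ℝ ξ z) (γ : SchwartzMap H ℂ) :
    Integrable (fun z => γ (L z)) := by
  have hker : LinearMap.ker L = ⊥ := by
    rw [LinearMap.ker_eq_bot']
    intro z hz
    have := hL z 0 z
    rw [hz, inner_zero_right] at this
    exact inner_self_eq_zero.mp this.symm
  obtain ⟨K, -, hK⟩ := L.exists_antilipschitzWith hker
  have hg : Function.HasTemperateGrowth (fun z => L z) :=
    (LinearMap.toContinuousLinearMap L).hasTemperateGrowth
  exact (SchwartzMap.compCLMOfAntilipschitz ℝ hg hK γ).integrable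

theorem fourier_comp (Φ : (E × F) ≃L[ℝ] H)
    (hΦ : MeasurePreserving Φ (volume.prod volume) volume) (L : E →ₗ[ℝ] H)
    (hL : ∀ ξ y z, inner ℝ (Φ (ξ, y)) (L z) = inner ℝ ξ z) (γ : SchwartzMap H ℂ) :
    𝓕 (fun z => γ (L z)) = fun ξ => ∫ y : F, 𝓕 (⇑γ) (Φ (ξ, y)) := by
  set f : SchwartzMap H ℂ := 𝓕 γ with hf
  have hfc : (𝓕 (⇑γ) : H → ℂ) = ⇑f := by rw [hf, SchwartzMap.fourier_coe]
  rw [hfc]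
  set G : E → ℂ := fun ξ => ∫ y : F, f (Φ (ξ, y)) with hG
  have hemb : MeasurableEmbedding Φ := Φ.toHomeomorph.measurableEmbedding
  have hGc : Continuous G :=
    fiber_continuous (SchwartzMap.compCLMOfContinuousLinearEquiv ℝ Φ f)
  have hint : Integrable (fun z : E × F => f (Φ z)) (volume.prod volume) :=
    (hΦ.integrable_comp_emb hemb).2 f.integrable
  have hGi : Integrable G := hint.integral_prod_left
  have hinv : (fun z => γ (L z)) = 𝓕⁻ G := by
    funext z
    have h1 : γ (L z) = 𝓕⁻ (⇑f) (L z) := by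
      rw [← SchwartzMap.fourierInv_coe, hf, FourierTransform.fourierInv_fourier_eq]
    rw [h1, Real.fourierInv_eq, Real.fourierInv_eq, ← hΦ.integral_comp hemb,
      integral_prod]
    · congr 1
      funext ξ
      simp only [hL, hG, Circle.smul_def, smul_eq_mul]
      exact integral_const_mul _ _
    · have : Integrable (fun v : H => Real.fourierChar (inner ℝ v (L z)) • f v) := by
        refine (Real.fourierIntegral_convergent_iff (μ := volume) (f := f) (-(L z))).2
          f.integrable |>.congr ?_
        simp
      exact (hΦ.integrable_comp_emb hemb).2 this
  rw [hinv]
  refine hGc.fourier_fourierInv_eq hGi ?_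
  have h2 : Integrable (𝓕⁻ G) := hinv ▸ comp_integrable Φ L hL γ
  have h3 : 𝓕 G = fun z => 𝓕⁻ G (-z) := by
    funext z
    rw [Real.fourierInv_eq_fourier_neg, neg_neg]
  rw [h3]
  exact h2.comp_neg

theorem weighted_bound (Φ : (E × F) ≃L[ℝ] H)
    (hΦ : MeasurePreserving Φ (volume.prod volume) volume)
    (f : H → ℂ) (hf : Continuous f) (a : E → ℝ≥0∞) (b : H → ℝ≥0∞) (hb : Measurable b)
    (hb0 : ∀ z, b z ≠ 0) (hbt : ∀ z, b z ≠ ∞) (K : ℝ≥0∞)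
    (hK : ∀ ξ, ∫⁻ y : F, (a ξ / b (Φ (ξ, y))) ^ 2 ≤ K) :
    ∫⁻ ξ, (a ξ * ‖∫ y : F, f (Φ (ξ, y))‖ₑ) ^ 2 ≤ K * ∫⁻ ζ, (b ζ * ‖f ζ‖ₑ) ^ 2 := by
  have hm : Measurable fun ζ => (b ζ * ‖f ζ‖ₑ) ^ 2 :=
    (hb.mul hf.measurable.enorm).pow_const 2
  have hΦm : Measurable Φ := Φ.continuous.measurable
  have hm' : Measurable fun z => (b (Φ z) * ‖f (Φ z)‖ₑ) ^ 2 := hm.comp hΦm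
  rw [← hΦ.lintegral_comp hm, lintegral_prod _ hm'.aemeasurable,
    ← lintegral_const_mul _ hm'.lintegral_prod_right']
  refine lintegral_mono fun ξ => ?_
  have hΦξ : Measurable fun y => Φ (ξ, y) := hΦm.comp measurable_prodMk_left
  have key : a ξ * ‖∫ y : F, f (Φ (ξ, y))‖ₑ ≤
      ∫⁻ y, (a ξ / b (Φ (ξ, y))) * (b (Φ (ξ, y)) * ‖f (Φ (ξ, y))‖ₑ) := by
    calc a ξ * ‖∫ y : F, f (Φ (ξ, y))‖ₑ ≤ a ξ * ∫⁻ y, ‖f (Φ (ξ, y))‖ₑ := by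
          gcongr; exact enorm_integral_le_lintegral_enorm _
      _ = ∫⁻ y, a ξ * ‖f (Φ (ξ, y))‖ₑ := by
          exact (lintegral_const_mul _ (hf.measurable.comp hΦξ).enorm).symm
      _ = _ := by
          congr 1; funext y
          rw [← mul_assoc, ENNReal.div_mul_cancel (hb0 _) (hbt _)]
  have hold := ENNReal.lintegral_mul_le_Lp_mul_Lq (volume : Measure F)
    (p := 2) (q := 2) ⟨by norm_num, by norm_num, by norm_num⟩
    (f := fun y => a ξ / b (Φ (ξ, y)))
    (g := fun y => b (Φ (ξ, y)) * ‖f (Φ (ξ, y))‖ₑ)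
    ((hb.comp hΦξ).const_div _).aemeasurable
    ((hb.comp hΦξ).mul (hf.measurable.comp hΦξ).enorm).aemeasurable
  have h2 := pow_le_pow_left' (key.trans hold) 2
  refine h2.trans ?_
  rw [mul_pow, ← ENNReal.rpow_natCast, ← ENNReal.rpow_natCast, ← ENNReal.rpow_mul,
    ← ENNReal.rpow_mul]
  norm_num
  gcongr
  exact hK ξ

end AbstractPart

section KernelPart

/-- the real decay function `⟨x⟩^{-2α}` -/
noncomputable def gdec (d : ℕ) (α : ℝ) (x : EuclideanSpace ℝ (Fin d)) : ℝ :=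
  (1 + ‖x‖ ^ 2) ^ (-α)

theorem gdec_pos (d : ℕ) (α : ℝ) (x : EuclideanSpace ℝ (Fin d)) : 0 < gdec d α x := by
  unfold gdec; positivity

theorem gdec_continuous (d : ℕ) (α : ℝ) : Continuous (gdec d α) := by
  unfold gdec
  refine Continuous.rpow_const (by fun_prop) fun x => Or.inl (by positivity)

theorem gdec_le (d : ℕ) (α : ℝ) (hα : 0 < α) (a b : EuclideanSpace ℝ (Fin d)) 
    (h : 1 + ‖a‖ ^ 2 ≤ 4 * (1 + ‖b‖ ^ 2)) : gdec d α b ≤ 4 ^ α * gdec d α a := by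
  unfold gdec
  rw [Real.rpow_neg (by positivity), Real.rpow_neg (by positivity), ← div_eq_mul_inv,
    le_div_iff₀ (by positivity), inv_mul_le_iff₀ (by positivity), mul_comm,
    ← Real.mul_rpow (by positivity) (by positivity)]
  exact Real.rpow_le_rpow (by positivity) h hα.le

theorem gdec_mul_le (d : ℕ) (α : ℝ) (hα : 0 < α) (a b : EuclideanSpace ℝ (Fin d)) :
    gdec d α (a - b) * gdec d α b ≤
      4 ^ α * gdec d α a * (gdec d α (a - b) + gdec d α b) := by
  have h1 := gdec_pos d α a
  have h2 := gdec_pos d α b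
  have h3 := gdec_pos d α (a - b)
  have h4 : (0:ℝ) < 4 ^ α := by positivity
  have ht : ‖a‖ ≤ ‖a - b‖ + ‖b‖ := by simpa using norm_add_le (a - b) b
  have hn := norm_nonneg a
  have hsq : ‖a‖ ^ 2 ≤ (‖a - b‖ + ‖b‖) ^ 2 := by gcongr
  rcases le_total ‖a - b‖ ‖b‖ with h | h
  · have := gdec_le d α hα a b (by nlinarith [norm_nonneg (a - b), norm_nonneg b])
    calc _ ≤ gdec d α (a - b) * (4 ^ α * gdec d α a) := by gcongr
      _ ≤ _ := by nlinarith [mul_pos (mul_pos h4 h1) h2]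
  · have := gdec_le d α hα a (a - b) (by nlinarith [norm_nonneg (a - b), norm_nonneg b])
    calc _ ≤ (4 ^ α * gdec d α a) * gdec d α b := by gcongr
      _ ≤ _ := by nlinarith [mul_pos (mul_pos h4 h1) h3]

theorem gdec_conv (d : ℕ) (α : ℝ) (hα : (d : ℝ) / 2 < α) :
    ∃ K : ℝ≥0∞, K ≠ ∞ ∧ ∀ a : EuclideanSpace ℝ (Fin d),
      ∫⁻ b, ENNReal.ofReal (gdec d α (a - b) * gdec d α b) ≤ K * ENNReal.ofReal (gdec d α a) := by
  have hα0 : 0 < α := lt_of_le_of_lt (by positivity) hα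
  have hm : Measurable (gdec d α) := (gdec_continuous d α).measurable
  have hI : ∫⁻ b, ENNReal.ofReal (gdec d α b) ≠ ∞ := by
    have : Integrable (gdec d α) := by
      have := integrable_rpow_neg_one_add_norm_sq (E := EuclideanSpace ℝ (Fin d))
        (μ := volume) (r := 2 * α) (by simp; linarith)
      convert this using 2 with x
      unfold gdec
      congr 1; ring
    exact this.lintegral_lt_top.ne
  refine ⟨ENNReal.ofReal (4 ^ α) * (2 * ∫⁻ b, ENNReal.ofReal (gdec d α b)), by finiteness, ?_⟩
  intro a
  calc ∫⁻ b, ENNReal.ofReal (gdec d α (a - b) * gdec d α b)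
      ≤ ∫⁻ b, ENNReal.ofReal (4 ^ α * gdec d α a) * 
          (ENNReal.ofReal (gdec d α (a - b)) + ENNReal.ofReal (gdec d α b)) := by
        refine lintegral_mono fun b => ?_
        rw [← ENNReal.ofReal_add (gdec_pos _ _ _).le (gdec_pos _ _ _).le,
          ← ENNReal.ofReal_mul (by have := gdec_pos d α a; positivity)]
        exact ENNReal.ofReal_le_ofReal (gdec_mul_le d α hα0 a b)
    _ = ENNReal.ofReal (4 ^ α * gdec d α a) * (2 * ∫⁻ b, ENNReal.ofReal (gdec d α b)) := by
        rw [lintegral_const_mul _ (by fun_prop), lintegral_add_right _ (by fun_prop),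
          lintegral_sub_left_eq_self (fun b => ENNReal.ofReal (gdec d α b)) a, two_mul]
    _ = _ := by
        rw [ENNReal.ofReal_mul (by positivity)]; ring

/-- splitting of Euclidean space along an index equivalence -/
noncomputable def spE {I A B : Type*} [Fintype I] [Fintype A] [Fintype B] (e : I ≃ A ⊕ B) :
    (EuclideanSpace ℝ A × EuclideanSpace ℝ B) ≃L[ℝ] EuclideanSpace ℝ I :=
  (WithLp.prodContinuousLinearEquiv 2 ℝ (EuclideanSpace ℝ A) (EuclideanSpace ℝ B)).symm.trans
    ((PiLp.sumPiLpEquivProdLpPiLp (𝕜 := ℝ) 2 (fun _ : A ⊕ B => ℝ)).symm.trans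
      (LinearIsometryEquiv.piLpCongrLeft 2 ℝ ℝ e.symm)).toContinuousLinearEquiv

theorem spE_apply {I A B : Type*} [Fintype I] [Fintype A] [Fintype B] (e : I ≃ A ⊕ B)
    (z : EuclideanSpace ℝ A × EuclideanSpace ℝ B) (i : I) :
    spE e z i = Sum.elim (fun a => z.1 a) (fun b => z.2 b) (e i) := by
  simp [spE]
  rcases e i with a | b <;> rfl

theorem spE_mp {I A B : Type*} [Fintype I] [Fintype A] [Fintype B] (e : I ≃ A ⊕ B) :
    MeasurePreserving (spE e) (volume.prod volume) volume :=
  (LinearIsometryEquiv.measurePreserving 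
    ((PiLp.sumPiLpEquivProdLpPiLp (𝕜 := ℝ) 2 (fun _ : A ⊕ B => ℝ)).symm.trans
      (LinearIsometryEquiv.piLpCongrLeft 2 ℝ ℝ e.symm))).comp
    (WithLp.volume_preserving_toLp (EuclideanSpace ℝ A) (EuclideanSpace ℝ B))

theorem spE_inner {I A B : Type*} [Fintype I] [Fintype A] [Fintype B] (e : I ≃ A ⊕ B)
    (z w : EuclideanSpace ℝ A × EuclideanSpace ℝ B) :
    inner ℝ (spE e z) (spE e w) = inner ℝ z.1 w.1 + inner ℝ z.2 w.2 := by
  simp only [PiLp.inner_apply, spE_apply]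
  rw [← e.symm.sum_comp]
  simp

noncomputable def uL {d n : ℕ} (y : PairSpace d n) (q : Fin n) : EuclideanSpace ℝ (Fin d) :=
  WithLp.toLp 2 fun i => y (Sum.inl (q, i))

noncomputable def uR {d n : ℕ} (y : PairSpace d n) (q : Fin n) : EuclideanSpace ℝ (Fin d) :=
  WithLp.toLp 2 fun i => y (Sum.inr (q, i))

noncomputable def sT {d n : ℕ} (y : PairSpace d n) : EuclideanSpace ℝ (Fin d) :=
  ∑ q, (uL y q + uR y q)

noncomputable def Pw {d n : ℕ} (α : ℝ) (y : PairSpace d n) : ℝ :=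
  ∏ q, (gdec d α (uL y q) * gdec d α (uR y q))

theorem uL_continuous {d n : ℕ} (q : Fin n) : Continuous fun y : PairSpace d n => uL y q := by
  unfold uL; fun_prop

theorem uR_continuous {d n : ℕ} (q : Fin n) : Continuous fun y : PairSpace d n => uR y q := by
  unfold uR; fun_prop

theorem sT_continuous {d n : ℕ} : Continuous fun y : PairSpace d n => sT y := by
  unfold sT
  exact continuous_finsetSum _ fun q _ => (uL_continuous q).add (uR_continuous q)

theorem Pw_continuous {d n : ℕ} (α : ℝ) : Continuous fun y : PairSpace d n => Pw α y := by
  unfold Pw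
  exact continuous_finsetProd _ fun q _ => ((gdec_continuous d α).comp (uL_continuous q)).mul
    ((gdec_continuous d α).comp (uR_continuous q))

theorem Pw_pos {d n : ℕ} (α : ℝ) (y : PairSpace d n) : 0 < Pw α y :=
  Finset.prod_pos fun _ _ => mul_pos (gdec_pos _ _ _) (gdec_pos _ _ _)

theorem weight_sq {d n : ℕ} (α : ℝ) (y : PairSpace d n) : weightS d n α y ^ 2 * Pw α y = 1 := by
  have key : ∀ x : EuclideanSpace ℝ (Fin d),
      ((1 + ∑ i, x i ^ 2) ^ (α / 2)) ^ 2 * gdec d α x = 1 := by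
    intro x
    have : ‖x‖ ^ 2 = ∑ i, x i ^ 2 := by simp [EuclideanSpace.norm_sq_eq]
    unfold gdec
    have hp : 0 < 1 + ∑ i, x i ^ 2 := by rw [← this]; positivity
    rw [this, ← Real.rpow_natCast, ← Real.rpow_mul hp.le, ← Real.rpow_add hp]
    norm_num
  unfold weightS Pw
  rw [← Finset.prod_pow, ← Finset.prod_mul_distrib]
  refine Finset.prod_eq_one fun q _ => ?_
  have h1 := key (uL y q)
  have h2 := key (uR y q)
  simp only [uL, uR] at h1 h2 ⊢
  rw [mul_pow, mul_mul_mul_comm, h1, h2, one_mul]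

theorem weightS_pos {d n : ℕ} (α : ℝ) (y : PairSpace d n) : 0 < weightS d n α y := by
  unfold weightS; positivity

theorem weightS_continuous {d n : ℕ} (α : ℝ) : Continuous (weightS d n α) := by
  unfold weightS
  refine continuous_finsetProd _ fun q _ => Continuous.mul ?_ ?_ <;>
  exact Continuous.rpow_const (by fun_prop) fun x => Or.inl (by positivity)

/-- index splitting -/
def idxE (d k p : ℕ) : ((Fin (k + p) × Fin d) ⊕ (Fin (k + p) × Fin d)) ≃
    ((Fin k × Fin d) ⊕ (Fin k × Fin d)) ⊕ ((Fin p × Fin d) ⊕ (Fin p × Fin d)) :=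
  let e : Fin (k + p) × Fin d ≃ (Fin k × Fin d) ⊕ (Fin p × Fin d) :=
    (Equiv.prodCongr finSumFinEquiv.symm (Equiv.refl _)).trans (Equiv.sumProdDistrib _ _ _)
  (Equiv.sumCongr e e).trans (Equiv.sumSumSumComm _ _ _ _)

theorem uL_castAdd {d k p : ℕ} (z : PairSpace d k × PairSpace d p) (q : Fin k) :
    uL (spE (idxE d k p) z) (Fin.castAdd p q) = uL z.1 q := by
  ext i; simp [uL, spE_apply, idxE]
theorem uR_castAdd {d k p : ℕ} (z : PairSpace d k × PairSpace d p) (q : Fin k) :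
    uR (spE (idxE d k p) z) (Fin.castAdd p q) = uR z.1 q := by
  ext i; simp [uR, spE_apply, idxE]
theorem uL_natAdd {d k p : ℕ} (z : PairSpace d k × PairSpace d p) (q : Fin p) :
    uL (spE (idxE d k p) z) (Fin.natAdd k q) = uL z.2 q := by
  ext i; simp [uL, spE_apply, idxE]
theorem uR_natAdd {d k p : ℕ} (z : PairSpace d k × PairSpace d p) (q : Fin p) :
    uR (spE (idxE d k p) z) (Fin.natAdd k q) = uR z.2 q := by
  ext i; simp [uR, spE_apply, idxE]

theorem sT_split {d k p : ℕ} (z : PairSpace d k × PairSpace d p) :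
    sT (spE (idxE d k p) z) = sT z.1 + sT z.2 := by
  simp only [sT, Fin.sum_univ_add, uL_castAdd, uR_castAdd, uL_natAdd, uR_natAdd]

theorem Pw_split {d k p : ℕ} (α : ℝ) (z : PairSpace d k × PairSpace d p) :
    Pw α (spE (idxE d k p) z) = Pw α z.1 * Pw α z.2 := by
  simp only [Pw, Fin.prod_univ_add, uL_castAdd, uR_castAdd, uL_natAdd, uR_natAdd]

/-- kernel bound, as a predicate of `p` -/
def KerBound (d : ℕ) (α : ℝ) (p : ℕ) : Prop :=
  ∃ K : ℝ≥0∞, K ≠ ∞ ∧ ∀ a : EuclideanSpace ℝ (Fin d),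
      ∫⁻ y : PairSpace d p, ENNReal.ofReal (gdec d α (a - sT y) * Pw α y) ≤
        K * ENNReal.ofReal (gdec d α a)

theorem ker_meas {d n : ℕ} (α : ℝ) (a : EuclideanSpace ℝ (Fin d)) :
    Measurable fun y : PairSpace d n => ENNReal.ofReal (gdec d α (a - sT y) * Pw α y) := by
  have h1 := gdec_continuous d α
  have h2 := sT_continuous (d := d) (n := n)
  have h3 := Pw_continuous (d := d) (n := n) α
  have : Continuous fun y : PairSpace d n => (gdec d α (a - sT y) * Pw α y) := by fun_prop
  exact this.measurable.ennreal_ofReal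

theorem kerBound_one (d : ℕ) (α : ℝ) (hα : (d : ℝ) / 2 < α) : KerBound d α 1 := by
  obtain ⟨K, hK, h⟩ := gdec_conv d α hα
  refine ⟨K * K, by finiteness, fun a => ?_⟩
  let e0 : Fin 1 × Fin d ≃ Fin d := Equiv.uniqueProd _ _
  let e := Equiv.sumCongr e0 e0
  have h0 := gdec_continuous d α
  have hm : Measurable fun z : EuclideanSpace ℝ (Fin d) × EuclideanSpace ℝ (Fin d) =>
      ENNReal.ofReal (gdec d α (a - sT (spE e z)) * Pw α (spE e z)) :=
    (ker_meas α a).comp (spE e).continuous.measurable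
  rw [← (spE_mp e).lintegral_comp (ker_meas α a), lintegral_prod _ hm.aemeasurable]
  have hl : ∀ z, uL (spE e z) 0 = z.1 := by
    intro z; ext i; simp [uL, spE_apply, e, e0]
  have hr : ∀ z, uR (spE e z) 0 = z.2 := by
    intro z; ext i; simp [uR, spE_apply, e, e0]
  have hs : ∀ z, sT (spE e z) = z.1 + z.2 := by
    intro z; simp [sT, hl, hr]
  have hP : ∀ z, Pw α (spE e z) = gdec d α z.1 * gdec d α z.2 := by
    intro z; simp [Pw, hl, hr]
  simp only [hs, hP]
  calc _ = ∫⁻ x, ENNReal.ofReal (gdec d α x) *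
        ∫⁻ y, ENNReal.ofReal (gdec d α ((a - x) - y) * gdec d α y) := by
        congr 1; funext x
        rw [← lintegral_const_mul _ (by fun_prop)]
        congr 1; funext y
        rw [← ENNReal.ofReal_mul (gdec_pos _ _ _).le, sub_sub]
        congr 1; ring
    _ ≤ ∫⁻ x, ENNReal.ofReal (gdec d α x) * (K * ENNReal.ofReal (gdec d α (a - x))) := by
        gcongr; exact h _
    _ = K * ∫⁻ x, ENNReal.ofReal (gdec d α (a - x) * gdec d α x) := by
        rw [← lintegral_const_mul _ (by fun_prop)]
        congr 1; funext y
        rw [ENNReal.ofReal_mul (gdec_pos _ _ _).le]; ring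
    _ ≤ K * (K * ENNReal.ofReal (gdec d α a)) := by gcongr; exact h a
    _ = _ := by ring

theorem kerBound (d : ℕ) (α : ℝ) (hα : (d : ℝ) / 2 < α) (p : ℕ) : KerBound d α p := by
  induction p with
  | zero =>
    refine ⟨1, by simp, fun a => ?_⟩
    rw [volume_euclideanSpace_eq_dirac, lintegral_dirac]
    simp [sT, Pw]
  | succ p ih =>
    obtain ⟨K, hK, h⟩ := ih
    obtain ⟨K₁, hK₁, h₁⟩ := kerBound_one d α hα
    refine ⟨K₁ * K, by finiteness, fun a => ?_⟩
    have hm : Measurable fun z : PairSpace d p × PairSpace d 1 =>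
        ENNReal.ofReal (gdec d α (a - sT (spE (idxE d p 1) z)) * Pw α (spE (idxE d p 1) z)) :=
      (ker_meas α a).comp (spE (idxE d p 1)).continuous.measurable
    rw [← (spE_mp (idxE d p 1)).lintegral_comp (ker_meas α a), lintegral_prod _ hm.aemeasurable]
    simp only [sT_split, Pw_split]
    calc _ = ∫⁻ x : PairSpace d p, ENNReal.ofReal (Pw α x) *
          ∫⁻ y : PairSpace d 1, ENNReal.ofReal (gdec d α ((a - sT x) - sT y) * Pw α y) := by
          congr 1; funext x
          rw [← lintegral_const_mul _ (ker_meas α _)]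
          congr 1; funext y
          rw [← ENNReal.ofReal_mul (Pw_pos _ _).le, sub_sub]
          congr 1; ring
      _ ≤ ∫⁻ x : PairSpace d p, ENNReal.ofReal (Pw α x) *
            (K₁ * ENNReal.ofReal (gdec d α (a - sT x))) := by
          gcongr; exact h₁ _
      _ = K₁ * ∫⁻ x : PairSpace d p, ENNReal.ofReal (gdec d α (a - sT x) * Pw α x) := by
          rw [← lintegral_const_mul _ (ker_meas α _)]
          congr 1; funext y
          rw [ENNReal.ofReal_mul (gdec_pos _ _ _).le]; ring
      _ ≤ K₁ * (K * ENNReal.ofReal (gdec d α a)) := by gcongr; exact h a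
      _ = _ := by ring

end KernelPart

section FinalPart

/-- shear map -/
noncomputable def shearE {E F : Type*} [NormedAddCommGroup E] [InnerProductSpace ℝ E]
    [FiniteDimensional ℝ E] [NormedAddCommGroup F] [InnerProductSpace ℝ F] [FiniteDimensional ℝ F]
    (A : F →ₗ[ℝ] E) : (E × F) ≃L[ℝ] (E × F) :=
  LinearEquiv.toContinuousLinearEquiv
    { toFun := fun z => (z.1 - A z.2, z.2)
      invFun := fun z => (z.1 + A z.2, z.2)
      map_add' := fun x y => by
        ext
        · simp only [Prod.fst_add, Prod.snd_add, map_add]; abel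
        · simp
      map_smul' := fun c x => by
        ext
        · simp [smul_sub]
        · simp
      left_inv := fun x => by simp
      right_inv := fun x => by simp }

theorem shearE_apply {E F : Type*} [NormedAddCommGroup E] [InnerProductSpace ℝ E]
    [FiniteDimensional ℝ E] [NormedAddCommGroup F] [InnerProductSpace ℝ F] [FiniteDimensional ℝ F]
    (A : F →ₗ[ℝ] E) (z : E × F) : shearE A z = (z.1 - A z.2, z.2) := rfl

theorem shearE_mp {E F : Type*} [NormedAddCommGroup E] [InnerProductSpace ℝ E]
    [FiniteDimensional ℝ E] [NormedAddCommGroup F] [InnerProductSpace ℝ F] [FiniteDimensional ℝ F]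
    [MeasurableSpace E] [BorelSpace E] [MeasurableSpace F] [BorelSpace F]
    (A : F →ₗ[ℝ] E) :
    MeasurePreserving (shearE A) (volume.prod volume) (volume.prod volume) := by
  have hA : Continuous A := A.continuous_of_finiteDimensional
  have h1 : MeasurePreserving (fun p : F × E => (p.1, p.2 - A p.1))
      (volume.prod volume) (volume.prod volume) := by
    refine (MeasurePreserving.id (volume : Measure F)).skew_product (μc := volume) (μd := volume)
      (g := fun y x => x - A y) ?_ ?_
    · exact Continuous.measurable (by simp only [Function.uncurry_def]; fun_prop)
    · exact Filter.Eventually.of_forall fun y => (measurePreserving_sub_right volume (A y)).map_eq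
  exact (Measure.measurePreserving_swap.comp h1).comp Measure.measurePreserving_swap

/-- the values substituted in the last `p` slots -/
noncomputable def Bm {d k : ℕ} (p : ℕ) (φ : Fin d → (Fin k × Fin d) ⊕ (Fin k × Fin d)) :
    PairSpace d k →ₗ[ℝ] PairSpace d p where
  toFun z := WithLp.toLp 2 (Sum.elim (fun q => z (φ q.2)) (fun q => z (φ q.2)))
  map_add' x y := by ext (i | i) <;> simp
  map_smul' c x := by ext (i | i) <;> simp

noncomputable def Am {d k : ℕ} (p : ℕ) (φ : Fin d → (Fin k × Fin d) ⊕ (Fin k × Fin d)) :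
    PairSpace d p →ₗ[ℝ] PairSpace d k := LinearMap.adjoint (Bm p φ)

theorem Am_apply {d k p : ℕ} (φ : Fin d → (Fin k × Fin d) ⊕ (Fin k × Fin d))
    (y : PairSpace d p) (m) :
    Am p φ y m = ∑ i, if φ i = m then sT y i else 0 := by
  classical
  have h1 : Am p φ y m = inner ℝ (Am p φ y) (EuclideanSpace.single m (1:ℝ)) := by
    rw [EuclideanSpace.inner_single_right]; simp
  rw [h1, Am, LinearMap.adjoint_inner_left, PiLp.inner_apply, Fintype.sum_sum_type,
    Fintype.sum_prod_type_right, Fintype.sum_prod_type_right, ← Finset.sum_add_distrib]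
  refine Finset.sum_congr rfl fun i _ => ?_
  have hs : sT y i = ∑ q, (y (Sum.inl (q, i)) + y (Sum.inr (q, i))) := by
    simp [sT, uL, uR]
  rw [hs]
  simp only [Bm, LinearMap.coe_mk, AddHom.coe_mk, Sum.elim_inl, Sum.elim_inr,
    PiLp.single_apply]
  split_ifs with h
  · simp [Finset.sum_add_distrib]
  · simp

noncomputable def Lm {d k : ℕ} (p : ℕ) (φ : Fin d → (Fin k × Fin d) ⊕ (Fin k × Fin d)) :
    PairSpace d k →ₗ[ℝ] PairSpace d (k + p) :=
  (spE (idxE d k p)).toLinearEquiv.toLinearMap ∘ₗ (LinearMap.id.prod (Bm p φ))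

theorem Lm_apply {d k p : ℕ} (φ : Fin d → (Fin k × Fin d) ⊕ (Fin k × Fin d)) (z : PairSpace d k) :
    Lm p φ z = spE (idxE d k p) (z, Bm p φ z) := rfl

noncomputable def Phi {d k : ℕ} (p : ℕ) (φ : Fin d → (Fin k × Fin d) ⊕ (Fin k × Fin d)) :
    (PairSpace d k × PairSpace d p) ≃L[ℝ] PairSpace d (k + p) :=
  (shearE (Am p φ)).trans (spE (idxE d k p))

theorem Phi_apply {d k p : ℕ} (φ : Fin d → (Fin k × Fin d) ⊕ (Fin k × Fin d))
    (z : PairSpace d k × PairSpace d p) :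
    Phi p φ z = spE (idxE d k p) (z.1 - Am p φ z.2, z.2) := rfl

theorem Phi_mp {d k p : ℕ} (φ : Fin d → (Fin k × Fin d) ⊕ (Fin k × Fin d)) :
    MeasurePreserving (Phi p φ) (volume.prod volume) volume :=
  (spE_mp (idxE d k p)).comp (shearE_mp (Am p φ))

theorem Phi_inner {d k p : ℕ} (φ : Fin d → (Fin k × Fin d) ⊕ (Fin k × Fin d))
    (ξ : PairSpace d k) (y : PairSpace d p) (z : PairSpace d k) :
    inner ℝ (Phi p φ (ξ, y)) (Lm p φ z) = inner ℝ ξ z := by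
  rw [Phi_apply, Lm_apply, spE_inner]
  simp only [inner_sub_left, Am, LinearMap.adjoint_inner_left]
  ring

theorem eLpNorm_two_eq {X : Type*} [MeasurableSpace X] (μ : Measure X) (f : X → ℂ) :
    eLpNorm f 2 μ = (∫⁻ x, ‖f x‖ₑ ^ 2 ∂μ) ^ (1 / 2 : ℝ) := by
  rw [eLpNorm_eq_lintegral_rpow_enorm_toReal (by norm_num) (by norm_num)]
  simp

theorem one_side {d k p : ℕ} (α : ℝ) (φ : Fin d → (Fin k × Fin d) ⊕ (Fin k × Fin d))
    (K : ℝ≥0∞) (hK : ∀ a : EuclideanSpace ℝ (Fin d),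
      ∫⁻ y : PairSpace d p, ENNReal.ofReal (gdec d α (a - sT y) * Pw α y) ≤
        K * ENNReal.ofReal (gdec d α a))
    (hR : ∀ ξ : PairSpace d k, ∃ R : ℝ, 0 < R ∧ ∃ v, ∀ y : PairSpace d p,
      Pw α (ξ - Am p φ y) = R * gdec d α (v - sT y))
    (γ : SchwartzMap (PairSpace d (k + p)) ℂ) :
    eLpNorm (fun ζ : PairSpace d k =>
        (weightS d k α ζ : ℂ) * 𝓕 (fun z => γ (Lm p φ z)) ζ) 2 volume ≤
      K ^ (1 / 2 : ℝ) * eLpNorm (fun ζ : PairSpace d (k + p) =>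
        (weightS d (k + p) α ζ : ℂ) * 𝓕 (⇑γ) ζ) 2 volume := by
  rw [fourier_comp (Phi p φ) (Phi_mp φ) (Lm p φ) (Phi_inner φ) γ, eLpNorm_two_eq, eLpNorm_two_eq,
    ← ENNReal.mul_rpow_of_nonneg _ _ (by norm_num)]
  refine ENNReal.rpow_le_rpow ?_ (by norm_num)
  have hw : ∀ (n : ℕ) (ζ : PairSpace d n), ‖(weightS d n α ζ : ℂ)‖ₑ =
      ENNReal.ofReal (weightS d n α ζ) := by
    intro n ζ
    rw [← ofReal_norm, Complex.norm_real, Real.norm_of_nonneg (weightS_pos α ζ).le]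
  simp only [enorm_mul, hw]
  refine weighted_bound (Phi p φ) (Phi_mp φ) (𝓕 (⇑γ)) ?_
    (fun ξ => ENNReal.ofReal (weightS d k α ξ)) (fun ζ => ENNReal.ofReal (weightS d (k + p) α ζ))
    (weightS_continuous α).measurable.ennreal_ofReal ?_ ?_ K ?_
  · rw [← SchwartzMap.fourier_coe]; exact (𝓕 γ).continuous
  · intro z; simpa using weightS_pos α z
  · intro z; simp
  · intro ξ
    obtain ⟨R, hR0, v, hv⟩ := hR ξ
    have h0 : Pw α ξ = R * gdec d α v := by
      have := hv 0
      have hs0 : sT (0 : PairSpace d p) = 0 := by ext i; simp [sT, uL, uR]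
      simpa [hs0] using this
    have hg := gdec_pos d α v
    have hint : ∀ y : PairSpace d p, (ENNReal.ofReal (weightS d k α ξ) /
        ENNReal.ofReal (weightS d (k + p) α (Phi p φ (ξ, y)))) ^ 2 =
        ENNReal.ofReal (gdec d α v)⁻¹ * ENNReal.ofReal (gdec d α (v - sT y) * Pw α y) := by
      intro y
      rw [← ENNReal.ofReal_div_of_pos (weightS_pos _ _),
        ← ENNReal.ofReal_pow (div_pos (weightS_pos _ _) (weightS_pos _ _)).le,
        ← ENNReal.ofReal_mul (by positivity)]
      congr 1
      have e1 := weight_sq α ξ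
      have e2 := weight_sq α (Phi p φ (ξ, y))
      have e3 : Pw α (Phi p φ (ξ, y)) = R * gdec d α (v - sT y) * Pw α y := by
        rw [Phi_apply, Pw_split, hv y]
      rw [h0] at e1
      rw [e3] at e2
      have p1 := weightS_pos α ξ
      have p2 := weightS_pos α (Phi p φ (ξ, y))
      rw [div_pow, div_eq_iff (by positivity)]
      generalize weightS d k α ξ = a at *
      generalize weightS d (k + p) α (Phi p φ (ξ, y)) = b at *
      field_simp
      have hRg : R ≠ 0 := hR0.ne'
      apply mul_left_cancel₀ hRg
      linear_combination e1 - e2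
    simp only [hint]
    rw [lintegral_const_mul _ (ker_meas α v)]
    calc _ ≤ ENNReal.ofReal (gdec d α v)⁻¹ * (K * ENNReal.ofReal (gdec d α v)) := by
          gcongr; exact hK v
      _ = K := by
          rw [mul_left_comm, ← ENNReal.ofReal_mul (by positivity), inv_mul_cancel₀ hg.ne']
          simp

theorem hR_left {d k p : ℕ} (α : ℝ) (j : Fin k) (ξ : PairSpace d k) :
    ∃ R : ℝ, 0 < R ∧ ∃ v, ∀ y : PairSpace d p,
      Pw α (ξ - Am p (fun i => Sum.inl (j, i)) y) = R * gdec d α (v - sT y) := by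
  classical
  refine ⟨(∏ q ∈ Finset.univ.erase j, gdec d α (uL ξ q)) * ∏ q, gdec d α (uR ξ q), ?_,
    uL ξ j, fun y => ?_⟩
  · exact mul_pos (Finset.prod_pos fun _ _ => gdec_pos _ _ _)
      (Finset.prod_pos fun _ _ => gdec_pos _ _ _)
  have h1 : uL (ξ - Am p (fun i => Sum.inl (j, i)) y) j = uL ξ j - sT y := by
    ext i; simp [uL, Am_apply]
  have h2 : ∀ q, q ≠ j → uL (ξ - Am p (fun i => Sum.inl (j, i)) y) q = uL ξ q := by
    intro q hq; ext i; simp [uL, Am_apply, hq.symm]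
  have h3 : ∀ q, uR (ξ - Am p (fun i => Sum.inl (j, i)) y) q = uR ξ q := by
    intro q; ext i; simp [uR, Am_apply]
  simp only [Pw, Finset.prod_mul_distrib, h3]
  rw [← Finset.mul_prod_erase _ _ (Finset.mem_univ j), h1,
    Finset.prod_congr rfl fun q hq => by rw [h2 q (Finset.ne_of_mem_erase hq)]]
  ring

theorem hR_right {d k p : ℕ} (α : ℝ) (j : Fin k) (ξ : PairSpace d k) :
    ∃ R : ℝ, 0 < R ∧ ∃ v, ∀ y : PairSpace d p,
      Pw α (ξ - Am p (fun i => Sum.inr (j, i)) y) = R * gdec d α (v - sT y) := by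
  classical
  refine ⟨(∏ q ∈ Finset.univ.erase j, gdec d α (uR ξ q)) * ∏ q, gdec d α (uL ξ q), ?_,
    uR ξ j, fun y => ?_⟩
  · exact mul_pos (Finset.prod_pos fun _ _ => gdec_pos _ _ _)
      (Finset.prod_pos fun _ _ => gdec_pos _ _ _)
  have h1 : uR (ξ - Am p (fun i => Sum.inr (j, i)) y) j = uR ξ j - sT y := by
    ext i; simp [uR, Am_apply]
  have h2 : ∀ q, q ≠ j → uR (ξ - Am p (fun i => Sum.inr (j, i)) y) q = uR ξ q := by
    intro q hq; ext i; simp [uR, Am_apply, hq.symm]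
  have h3 : ∀ q, uL (ξ - Am p (fun i => Sum.inr (j, i)) y) q = uL ξ q := by
    intro q; ext i; simp [uL, Am_apply]
  simp only [Pw, Finset.prod_mul_distrib, h3]
  rw [← Finset.mul_prod_erase _ (fun q => gdec d α (uR _ q)) (Finset.mem_univ j), h1,
    Finset.prod_congr (s₁ := Finset.univ.erase j) rfl fun q hq => by
      rw [h2 q (Finset.ne_of_mem_erase hq)]]
  ring

theorem contractB_eq {d k p : ℕ} (j : Fin k) (γ : PairSpace d (k + p) → ℂ) :
    contractB d k p j γ = (fun z => γ (Lm p (fun i => Sum.inl (j, i)) z)) -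
      (fun z => γ (Lm p (fun i => Sum.inr (j, i)) z)) := by
  funext z
  simp only [contractB, Pi.sub_apply]
  congr 2 <;>
  · ext (⟨q, i⟩ | ⟨q, i⟩) <;>
    · refine Fin.addCases (fun q => ?_) (fun q => ?_) q <;>
      simp [toEuc, Lm_apply, spE_apply, idxE, Bm]

end FinalPart

/-- Theorem 3.2. Let `d ≥ 1`, `p ≥ 1`, `α > d/2`. Then there is a
constant `C_α > 0` depending only on `α, d, p` (independent of `k` and `j`) such that
for every `k ≥ 1`, `1 ≤ j ≤ k` and every Schwartz kernel `γ` on `ℝ^{d(k+p)} × ℝ^{d(k+p)}`,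
`‖S^{(k,α)} B_{j;k+1,…,k+p} γ‖_{L²} ≤ C_α ‖S^{(k+p,α)} γ‖_{L²}`; both sides are expressed
by Plancherel as `L²` norms of weighted Fourier transforms. -/
theorem contraction_sobolev_bound
    (d p : ℕ) (hd : 1 ≤ d) (hp : 1 ≤ p)
    (α : ℝ) (hα : (d : ℝ) / 2 < α) :
    ∃ C : ℝ, 0 < C ∧
      ∀ (k : ℕ), 1 ≤ k → ∀ (j : Fin k),
        ∀ γ : SchwartzMap (PairSpace d (k + p)) ℂ,
          eLpNorm
            (fun ζ : PairSpace d k =>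
              (weightS d k α ζ : ℂ) * 𝓕 (contractB d k p j ⇑γ) ζ) 2 volume ≤
          ENNReal.ofReal C *
            eLpNorm
              (fun ζ : PairSpace d (k + p) =>
                (weightS d (k + p) α ζ : ℂ) * 𝓕 (⇑γ) ζ) 2 volume := by
  obtain ⟨K, hKt, hK⟩ := kerBound d α hα p
  refine ⟨2 * (K ^ (1 / 2 : ℝ)).toReal + 1, by positivity, ?_⟩
  intro k _ j γ
  have hKh : K ^ (1 / 2 : ℝ) ≠ ∞ := ENNReal.rpow_ne_top_of_nonneg (by norm_num) hKt
  have b1 := one_side α (fun i => Sum.inl (j, i)) K hK (hR_left α j) γ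
  have b2 := one_side α (fun i => Sum.inr (j, i)) K hK (hR_right α j) γ
  set N := eLpNorm (fun ζ : PairSpace d (k + p) =>
    (weightS d (k + p) α ζ : ℂ) * 𝓕 (⇑γ) ζ) 2 volume with hN
  have hi : ∀ φ : Fin d → (Fin k × Fin d) ⊕ (Fin k × Fin d),
      Integrable (fun z => γ (Lm p φ z)) := fun φ =>
    comp_integrable (Phi p φ) (Lm p φ) (Phi_inner φ) γ
  have hms : ∀ φ : Fin d → (Fin k × Fin d) ⊕ (Fin k × Fin d),
      AEStronglyMeasurable (fun ζ : PairSpace d k =>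
        (weightS d k α ζ : ℂ) * 𝓕 (fun z => γ (Lm p φ z)) ζ) volume := by
    intro φ
    have h1 : Continuous (𝓕 (fun z => γ (Lm p φ z))) :=
      VectorFourier.fourierIntegral_continuous Real.continuous_fourierChar
        (by exact continuous_inner) (hi φ)
    exact ((Complex.continuous_ofReal.comp (weightS_continuous α)).mul h1).aestronglyMeasurable
  have heq : (fun ζ : PairSpace d k =>
      (weightS d k α ζ : ℂ) * 𝓕 (contractB d k p j ⇑γ) ζ) =
      (fun ζ => (weightS d k α ζ : ℂ) * 𝓕 (fun z => γ (Lm p (fun i => Sum.inl (j, i)) z)) ζ) -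
      (fun ζ => (weightS d k α ζ : ℂ) * 𝓕 (fun z => γ (Lm p (fun i => Sum.inr (j, i)) z)) ζ) := by
    funext ζ
    rw [contractB_eq, Pi.sub_apply, ← mul_sub]
    congr 1
    simp only [Real.fourier_eq, Pi.sub_apply, smul_sub]
    exact integral_sub ((Real.fourierIntegral_convergent_iff ζ).2 (hi _))
      ((Real.fourierIntegral_convergent_iff ζ).2 (hi _))
  rw [heq]
  refine (eLpNorm_sub_le (hms _) (hms _) (by norm_num)).trans ?_
  calc _ ≤ K ^ (1 / 2 : ℝ) * N + K ^ (1 / 2 : ℝ) * N := add_le_add b1 b2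
    _ = (2 * K ^ (1 / 2 : ℝ)) * N := by ring
    _ ≤ _ := by
      gcongr
      rw [ENNReal.ofReal_add (by positivity) (by norm_num), ENNReal.ofReal_mul (by norm_num),
        ENNReal.ofReal_toReal hKh]
      simp
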